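/- Let β ∈ [0,1] and let f ∈ 𝒜_β with f(z) = z + Σ_{n≥2} a_n z^n. Then |a_n| ≤ 2/(n − β(n−1)) for every n ≥ 2, and this inequality is sharp for each n (equality being attained by the function f̃). -/

import Mathlib

open Metric Filter Set

noncomputable def tcoef (β : ℝ) (n : ℕ) : ℝ :=
  if n = 0 then 0 else if n = 1 then 1 else 2 / ((n : ℝ) - β * ((n : ℝ) - 1))

noncomputable def ftildeC (β : ℝ) (z : ℂ) : ℂ := ∑' n : ℕ, (tcoef β n : ℂ) * z ^ n

/-- The class `𝒜_β`: analytic `f(z) = z + ∑_{n≥2} aₙ zⁿ` on the unit disk with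
`Re (β f(z)/z + (1-β) f'(z)) > 0`. -/
def IsAbeta (β : ℝ) (a : ℕ → ℂ) (f : ℂ → ℂ) : Prop :=
  a 0 = 0 ∧ a 1 = 1 ∧
  (∀ z ∈ Metric.ball (0 : ℂ) 1, HasSum (fun n => a n * z ^ n) (f z)) ∧
  ∀ z ∈ Metric.ball (0 : ℂ) 1, z ≠ 0 →
    0 < ((β : ℂ) * f z / z + (1 - (β : ℂ)) * deriv f z).re

/-- Termwise differentiation of a power series converging on the unit disk. -/
theorem hasSum_deriv_of_hasSum_ball {a : ℕ → ℂ} {f : ℂ → ℂ}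
    (h : ∀ z ∈ ball (0 : ℂ) 1, HasSum (fun n => a n * z ^ n) (f z))
    {z : ℂ} (hz : z ∈ ball (0 : ℂ) 1) :
    HasSum (fun n : ℕ => ((n : ℂ) + 1) * a (n + 1) * z ^ n) (deriv f z) := by
  obtain ⟨r, hzr, hr1⟩ := exists_between (mem_ball_zero_iff.1 hz)
  have hr0 : 0 ≤ r := (norm_nonneg z).trans hzr.le
  have hrb : (r : ℂ) ∈ ball (0 : ℂ) 1 := by
    simpa [abs_of_nonneg hr0] using hr1
  have hzb : z ∈ ball (0 : ℂ) r := mem_ball_zero_iff.2 hzr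
  have key := Complex.hasSum_deriv_of_summable_norm (F := fun (n : ℕ) (w : ℂ) => a n * w ^ n)
    (U := ball (0 : ℂ) r) (h _ hrb).summable.norm (fun n => by fun_prop) isOpen_ball
    (fun n w hw => by
      have hw' : ‖w‖ ≤ r := (mem_ball_zero_iff.1 hw).le
      simp only [norm_mul, norm_pow, Complex.norm_real, Real.norm_of_nonneg hr0]
      gcongr) hzb
  have heq : (fun w => ∑' n : ℕ, a n * w ^ n) =ᶠ[nhds z] f := by
    filter_upwards [isOpen_ball.mem_nhds hz] with w hw using (h w hw).tsum_eq
  rw [heq.deriv_eq, ← hasSum_nat_add_iff' 1] at key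
  simp only [deriv_const_mul_field', deriv_pow_field, Finset.range_one, Finset.sum_singleton,
    Nat.cast_zero, zero_mul, mul_zero, sub_zero, Nat.add_sub_cancel, Nat.cast_add,
    Nat.cast_one] at key
  convert! key using 2 with n
  ring

/-- The power series of `β f(z)/z + (1-β) f'(z)`. -/
theorem hasSum_mul_div_add_mul_deriv {a : ℕ → ℂ} {f : ℂ → ℂ} (β : ℝ) (h0 : a 0 = 0)
    (h : ∀ z ∈ ball (0 : ℂ) 1, HasSum (fun n => a n * z ^ n) (f z))
    {z : ℂ} (hz : z ∈ ball (0 : ℂ) 1) (hz0 : z ≠ 0) :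
    HasSum (fun n : ℕ => ((n : ℂ) + 1 - β * n) * a (n + 1) * z ^ n)
      ((β : ℂ) * f z / z + (1 - (β : ℂ)) * deriv f z) := by
  have h1 := (hasSum_nat_add_iff' 1).2 (h z hz)
  simp only [Finset.range_one, Finset.sum_singleton, h0, zero_mul, sub_zero] at h1
  have h2 := ((h1.mul_left (β : ℂ)).div_const z).add
    ((hasSum_deriv_of_hasSum_ball h hz).mul_left (1 - (β : ℂ)))
  convert! h2 using 2 with n
  field_simp
  ring

theorem integral_exp_int_mul_I (k : ℤ) :
    ∫ θ in (0 : ℝ)..2 * Real.pi, Complex.exp (k * θ * Complex.I) =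
      if k = 0 then 2 * (Real.pi : ℂ) else 0 := by
  split_ifs with hk
  · simp [hk]
  · have hc : (k : ℂ) * Complex.I ≠ 0 := by simp [hk]
    have h := integral_exp_mul_complex (a := 0) (b := 2 * Real.pi) hc
    have e : Complex.exp ((k : ℂ) * Complex.I * ((2 * Real.pi : ℝ) : ℂ)) = 1 := by
      rw [← Complex.exp_int_mul_two_pi_mul_I k]
      congr 1
      push_cast
      ring
    rw [e] at h
    simp only [Complex.ofReal_zero, mul_zero, Complex.exp_zero, sub_self, zero_div] at h
    rw [← h]
    congr 1 with θ
    ring_nf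

/-- Fourier coefficients of a power series restricted to a circle. -/
theorem hasSum_integral_powerSeries_mul_exp {c : ℕ → ℂ} {p : ℂ → ℂ} {r : ℝ}
    (hs : Summable fun n => c n * (r : ℂ) ^ n)
    (hp : ∀ θ : ℝ, HasSum (fun n => c n * (r * Complex.exp (θ * Complex.I)) ^ n)
      (p (r * Complex.exp (θ * Complex.I)))) (k : ℤ) :
    HasSum (fun n : ℕ => c n * (r : ℂ) ^ n * if (n : ℤ) + k = 0 then 2 * (Real.pi : ℂ) else 0)
      (∫ θ in (0 : ℝ)..2 * Real.pi,
        p (r * Complex.exp (θ * Complex.I)) * Complex.exp (k * θ * Complex.I)) := by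
  have key := intervalIntegral.hasSum_integral_of_dominated_convergence
    (μ := MeasureTheory.volume) (a := 0) (b := 2 * Real.pi)
    (F := fun (n : ℕ) (θ : ℝ) => c n * (r * Complex.exp (θ * Complex.I)) ^ n *
      Complex.exp (k * θ * Complex.I))
    (f := fun θ : ℝ => p (r * Complex.exp (θ * Complex.I)) * Complex.exp (k * θ * Complex.I))
    (fun n _ => ‖c n * (r : ℂ) ^ n‖)
    (fun n => (by fun_prop : Continuous _).aestronglyMeasurable)
    (fun n => Eventually.of_forall fun θ _ => by
      have e : ‖Complex.exp (k * θ * Complex.I)‖ = 1 := by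
        exact_mod_cast Complex.norm_exp_ofReal_mul_I (k * θ)
      simp [e, Complex.norm_exp_ofReal_mul_I])
    (Eventually.of_forall fun θ _ => hs.norm) (by simp)
    (Eventually.of_forall fun θ _ => (hp θ).mul_right _)
  convert! key using 2 with n
  rw [← integral_exp_int_mul_I, ← intervalIntegral.integral_const_mul]
  congr 1 with θ
  rw [mul_pow, ← Complex.exp_nat_mul, ← mul_assoc, mul_assoc, mul_assoc, mul_assoc,
    ← Complex.exp_add]
  push_cast
  ring_nf

/-- **Carathéodory's coefficient bound** for functions with nonnegative real part. -/
theorem norm_coeff_le_two_of_re_nonneg {c : ℕ → ℂ} {p : ℂ → ℂ} (hc : c 0 = 1)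
    (hp : ∀ z ∈ ball (0 : ℂ) 1, HasSum (fun n => c n * z ^ n) (p z))
    (hre : ∀ z ∈ ball (0 : ℂ) 1, 0 ≤ (p z).re) {n : ℕ} (hn : n ≠ 0) : ‖c n‖ ≤ 2 := by
  have main : ∀ r : ℝ, 0 < r → r < 1 → ‖c n‖ * r ^ n ≤ 2 := by
    intro r hr0 hr1
    have hmem : ∀ θ : ℝ, (r : ℂ) * Complex.exp (θ * Complex.I) ∈ ball (0 : ℂ) 1 := fun θ => by
      simpa [Complex.norm_exp_ofReal_mul_I, abs_of_pos hr0] using hr1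
    have hs : Summable fun n => c n * (r : ℂ) ^ n := by
      simpa using (hp _ (hmem 0)).summable
    have F := hasSum_integral_powerSeries_mul_exp hs (fun θ => hp _ (hmem θ))
    set g : ℝ → ℂ := fun θ => p (r * Complex.exp (θ * Complex.I)) with hg
    have hgc : Continuous g := by
      have : g = fun θ : ℝ => ∑' n, c n * (r * Complex.exp (θ * Complex.I)) ^ n :=
        funext fun θ => (hp _ (hmem θ)).tsum_eq.symm
      rw [this]
      refine continuous_tsum (fun n => by fun_prop) hs.norm fun n θ => ?_
      simp [Complex.norm_exp_ofReal_mul_I]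
    have I0 : ∫ θ in (0 : ℝ)..2 * Real.pi, g θ = 2 * Real.pi := by
      have h := (F 0).unique (hasSum_single 0 fun m hm => by simp [hm])
      simpa [hc] using h
    have In : ∫ θ in (0 : ℝ)..2 * Real.pi, g θ * Complex.exp (n * θ * Complex.I) = 0 := by
      have h := (F n).unique (hasSum_single 0 fun m hm => by
        rw [if_neg (by omega), mul_zero])
      simpa [hn] using h
    have Ineg : ∫ θ in (0 : ℝ)..2 * Real.pi, g θ * Complex.exp (-(n * θ * Complex.I)) =
        c n * r ^ n * (2 * Real.pi) := by
      have h := (F (-n)).unique (hasSum_single n fun m hm => by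
        rw [if_neg (by omega), mul_zero])
      simpa using h
    have Iconj : ∫ θ in (0 : ℝ)..2 * Real.pi,
        (starRingEnd ℂ) (g θ) * Complex.exp (-(n * θ * Complex.I)) = 0 := by
      have h := congrArg (starRingEnd ℂ) In
      rw [← intervalIntegral.intervalIntegral_conj, map_zero] at h
      rw [← h]
      congr 1 with θ
      simp [← Complex.exp_conj]
    have Ire : ∫ θ in (0 : ℝ)..2 * Real.pi, (g θ).re = 2 * Real.pi := by
      have h := Complex.reCLM.intervalIntegral_comp_comm
        (hgc.intervalIntegrable (μ := MeasureTheory.volume) 0 (2 * Real.pi))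
      rw [I0] at h
      simpa using h
    have Isum : ∫ θ in (0 : ℝ)..2 * Real.pi,
        ((2 * (g θ).re : ℝ) : ℂ) * Complex.exp (-(n * θ * Complex.I)) =
        c n * r ^ n * (2 * Real.pi) := by
      rw [← Ineg, ← add_zero (∫ θ in (0 : ℝ)..2 * Real.pi, g θ * _), ← Iconj,
        ← intervalIntegral.integral_add]
      · congr 1 with θ
        rw [← add_mul, Complex.add_conj]
      · exact (by fun_prop : Continuous _).intervalIntegrable _ _
      · exact (by fun_prop : Continuous _).intervalIntegrable _ _
    have hle := intervalIntegral.norm_integral_le_integral_norm (μ := MeasureTheory.volume)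
      (f := fun θ : ℝ => ((2 * (g θ).re : ℝ) : ℂ) * Complex.exp (-(n * θ * Complex.I)))
      Real.two_pi_pos.le
    have hnorm : ∀ θ : ℝ, ‖((2 * (g θ).re : ℝ) : ℂ) * Complex.exp (-(n * θ * Complex.I))‖ =
        2 * (g θ).re := fun θ => by
      have e : ‖Complex.exp (-(n * θ * Complex.I))‖ = 1 := by
        simpa using Complex.norm_exp_ofReal_mul_I (-(n * θ))
      rw [norm_mul, e, mul_one, Complex.norm_real, Real.norm_of_nonneg]
      exact mul_nonneg zero_le_two (hre _ (hmem θ))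
    simp only [hnorm, Isum, intervalIntegral.integral_const_mul, Ire] at hle
    have e : ‖c n * (r : ℂ) ^ n * (2 * Real.pi)‖ = ‖c n‖ * r ^ n * (2 * Real.pi) := by
      simp [abs_of_pos hr0, abs_of_pos Real.pi_pos]
    rw [e] at hle
    exact le_of_mul_le_mul_right hle Real.two_pi_pos
  have ht : Tendsto (fun r : ℝ => ‖c n‖ * r ^ n) (nhdsWithin 1 (Iio 1)) (nhds (‖c n‖ * 1 ^ n)) :=
    ((by fun_prop : Continuous fun r : ℝ => ‖c n‖ * r ^ n).tendsto 1).mono_left nhdsWithin_le_nhds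
  rw [one_pow, mul_one] at ht
  refine le_of_tendsto ht ?_
  filter_upwards [Ioo_mem_nhdsLT (zero_lt_one' ℝ)] with r hr using main r hr.1 hr.2

theorem one_le_sub_mul_sub_one {β : ℝ} (hβ : β ≤ 1) {n : ℕ} (hn : 1 ≤ n) :
    1 ≤ (n : ℝ) - β * ((n : ℝ) - 1) := by
  have : (1 : ℝ) ≤ n := by exact_mod_cast hn
  nlinarith

theorem norm_coeff_le_of_isAbeta {β : ℝ} (hβ : β ≤ 1) {a : ℕ → ℂ} {f : ℂ → ℂ}
    (hf : IsAbeta β a f) {n : ℕ} (hn : 2 ≤ n) :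
    ‖a n‖ ≤ 2 / ((n : ℝ) - β * ((n : ℝ) - 1)) := by
  obtain ⟨h0, h1, hs, hre⟩ := hf
  obtain ⟨m, rfl⟩ : ∃ m, n = m + 1 := ⟨n - 1, by omega⟩
  have hpos := one_le_sub_mul_sub_one hβ (show 1 ≤ m + 1 by omega)
  set c : ℕ → ℂ := fun n => ((n : ℂ) + 1 - β * n) * a (n + 1) with hc
  set p : ℂ → ℂ := fun z =>
    if z = 0 then 1 else (β : ℂ) * f z / z + (1 - (β : ℂ)) * deriv f z with hp
  have hsum : ∀ z ∈ ball (0 : ℂ) 1, HasSum (fun n => c n * z ^ n) (p z) := by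
    intro z hz
    by_cases hz0 : z = 0
    · have := hasSum_single (f := fun n => c n * z ^ n) 0 fun m hm => by simp [hz0, hm]
      simpa [hp, hz0, hc, h1] using this
    · simpa only [hp, if_neg hz0] using hasSum_mul_div_add_mul_deriv β h0 hs hz hz0
  have hpre : ∀ z ∈ ball (0 : ℂ) 1, 0 ≤ (p z).re := by
    intro z hz
    by_cases hz0 : z = 0
    · simp [hp, hz0]
    · simpa only [hp, if_neg hz0] using (hre z hz hz0).le
  have key := norm_coeff_le_two_of_re_nonneg (by simp [hc, h1]) hsum hpre
    (show m ≠ 0 by omega)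
  have e : ((m : ℂ) + 1 - β * m) = (((m + 1 : ℕ) - β * ((m + 1 : ℕ) - 1) : ℝ) : ℂ) := by
    push_cast
    ring
  simp only [hc] at key
  rw [e, norm_mul, Complex.norm_real, Real.norm_of_nonneg (by linarith)] at key
  rw [le_div_iff₀ (by linarith), mul_comm]
  exact key

theorem norm_tcoef_le_two {β : ℝ} (hβ : β ≤ 1) (n : ℕ) : ‖(tcoef β n : ℂ)‖ ≤ 2 := by
  rw [Complex.norm_real]
  unfold tcoef
  split_ifs with h0 h1
  · simp
  · simp
  · have h := one_le_sub_mul_sub_one hβ (show 1 ≤ n by omega)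
    rw [Real.norm_of_nonneg (by positivity)]
    exact div_le_self zero_le_two h

theorem hasSum_ftildeC {β : ℝ} (hβ : β ≤ 1) {z : ℂ} (hz : z ∈ ball (0 : ℂ) 1) :
    HasSum (fun n => (tcoef β n : ℂ) * z ^ n) (ftildeC β z) := by
  refine Summable.hasSum (Summable.of_norm_bounded (g := fun n => 2 * ‖z‖ ^ n)
    ((summable_geometric_of_lt_one (norm_nonneg z) (mem_ball_zero_iff.1 hz)).mul_left 2) ?_)
  intro n
  rw [norm_mul, norm_pow]
  gcongr
  exact norm_tcoef_le_two hβ n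

theorem one_lt_re_two_div_one_sub {z : ℂ} (hz : ‖z‖ < 1) : 1 < (2 / (1 - z)).re := by
  have hsq : z.re * z.re + z.im * z.im < 1 := by
    rw [← Complex.normSq_apply, Complex.normSq_eq_norm_sq]
    nlinarith [norm_nonneg z]
  have hx : z.re < 1 := (Complex.re_le_norm z).trans_lt hz
  have hpos : 0 < Complex.normSq (1 - z) := by
    rw [Complex.normSq_apply]
    simp only [Complex.sub_re, Complex.one_re, Complex.sub_im, Complex.one_im]
    nlinarith [mul_pos (sub_pos.2 hx) (sub_pos.2 hx), mul_self_nonneg (0 - z.im)]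
  have e : (2 / (1 - z)).re = 2 * (1 - z.re) / Complex.normSq (1 - z) := by
    simp [Complex.div_re]
  rw [e, one_lt_div hpos, Complex.normSq_apply]
  simp only [Complex.sub_re, Complex.one_re, Complex.sub_im, Complex.one_im]
  nlinarith

theorem isAbeta_ftildeC {β : ℝ} (hβ : β ≤ 1) :
    IsAbeta β (fun n => (tcoef β n : ℂ)) (ftildeC β) := by
  refine ⟨by simp [tcoef], by simp [tcoef], fun z hz => hasSum_ftildeC hβ hz,
    fun z hz hz0 => ?_⟩
  have h := hasSum_mul_div_add_mul_deriv (a := fun n => (tcoef β n : ℂ)) β (by simp [tcoef])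
    (fun z hz => hasSum_ftildeC hβ hz) hz hz0
  have hz1 := mem_ball_zero_iff.1 hz
  have h' : HasSum (fun n : ℕ => ((n : ℂ) + 1 - β * n) * (tcoef β (n + 1) : ℂ) * z ^ n)
      (2 / (1 - z) - 1) := by
    have g := ((hasSum_geometric_of_norm_lt_one hz1).mul_left 2).sub
      (hasSum_ite_eq (0 : ℕ) (1 : ℂ))
    convert! g using 2 with n
    rcases Nat.eq_zero_or_pos n with rfl | hn
    · norm_num [tcoef]
    · have hne : (n : ℂ) + 1 - n * β ≠ 0 := by
        have hpos := one_le_sub_mul_sub_one hβ (show 1 ≤ n + 1 by omega)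
        push_cast at hpos
        have : (n : ℝ) + 1 - n * β ≠ 0 := by linarith
        exact_mod_cast this
      have hn' : n ≠ 0 := hn.ne'
      simp only [tcoef, Nat.add_eq_zero_iff, hn', false_and, if_false, Nat.add_eq_right, sub_zero]
      push_cast
      rw [add_sub_cancel_right]
      field_simp
  rw [h.unique h', Complex.sub_re, Complex.one_re]
  exact sub_pos.2 (one_lt_re_two_div_one_sub hz1)

theorem stmt13 (β : ℝ) (hβ : β ∈ Set.Icc (0 : ℝ) 1)
    (a : ℕ → ℂ) (f : ℂ → ℂ) (hf : IsAbeta β a f) :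
    (∀ n : ℕ, 2 ≤ n → ‖a n‖ ≤ 2 / ((n : ℝ) - β * ((n : ℝ) - 1))) ∧
    -- sharpness for each `n`: equality is attained by `f̃ ∈ 𝒜_β`
    (IsAbeta β (fun n => (tcoef β n : ℂ)) (ftildeC β) ∧
      ∀ n : ℕ, 2 ≤ n →
        ‖((tcoef β n : ℝ) : ℂ)‖ = 2 / ((n : ℝ) - β * ((n : ℝ) - 1))) := by
  refine ⟨fun n hn => norm_coeff_le_of_isAbeta hβ.2 hf hn, isAbeta_ftildeC hβ.2,
    fun n hn => ?_⟩
  have h := one_le_sub_mul_sub_one hβ.2 (show 1 ≤ n by omega)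
  rw [Complex.norm_real, tcoef, if_neg (by omega), if_neg (by omega),
    Real.norm_of_nonneg (by positivity)]
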